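/- For each 1 ≤ j ≤ n−1 let V_j be a positive word whose letters lie among a_1, …, a_j. Then in the positive braid monoid B⁺_{n+1} one has Λ_1 V_1 Λ_2 V_2 ⋯ Λ_{n−1} V_{n−1} Λ_n = Δ V_1^{(n−1)} V_2^{(n−2)} ⋯ V_{n−1}^{(1)}. (These are the relations (3) of the Gröbner–Shirshov basis of B_{n+1} in the Artin–Garside generators.) -/

import Mathlib

/-- Defining relations of the braid monoid/group on `n` strands' generators `Fin n`
(generator `i : Fin n` represents the Artin generator `a_{i+1}`):
braid relations `a_{i+1} a_i a_{i+1} = a_i a_{i+1} a_i` and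
commutation `a_k a_s = a_s a_k` for `k - s ≥ 2`. -/
def braidRels (n : ℕ) : FreeMonoid (Fin n) → FreeMonoid (Fin n) → Prop := fun x y =>
  (∃ i j : Fin n, (i : ℕ) + 1 = j ∧
      x = .of j * .of i * .of j ∧ y = .of i * .of j * .of i) ∨
  (∃ i j : Fin n, (i : ℕ) + 2 ≤ j ∧
      x = .of j * .of i ∧ y = .of i * .of j)

/-- The positive braid monoid `B⁺_{n+1}`. -/
def BraidMonoid (n : ℕ) : Type := PresentedMonoid (braidRels n)

instance (n : ℕ) : Monoid (BraidMonoid n) :=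
  inferInstanceAs (Monoid (PresentedMonoid (braidRels n)))

/-- Relators of the braid group `B_{n+1}` on generators `Fin n`. -/
def braidRelators (n : ℕ) : Set (FreeGroup (Fin n)) :=
  {r | (∃ i j : Fin n, (i : ℕ) + 1 = j ∧
          r = .of j * .of i * .of j * (.of i * .of j * .of i)⁻¹) ∨
       (∃ i j : Fin n, (i : ℕ) + 2 ≤ j ∧
          r = .of j * .of i * (.of i * .of j)⁻¹)}

/-- The braid group `B_{n+1}`. -/
def BraidGroup (n : ℕ) : Type := PresentedGroup (braidRelators n)

instance (n : ℕ) : Group (BraidGroup n) :=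
  inferInstanceAs (Group (PresentedGroup (braidRelators n)))

namespace Braid

/-- The Artin generator `a_i` (`1 ≤ i ≤ n`) of the positive braid monoid;
junk value `1` outside this range. -/
def a (n i : ℕ) : BraidMonoid n :=
  if h : 1 ≤ i ∧ i ≤ n then PresentedMonoid.of (braidRels n) ⟨i - 1, by omega⟩ else 1

/-- The Artin generator `a_i` (`1 ≤ i ≤ n`) of the braid group; junk value `1` otherwise. -/
def b (n i : ℕ) : BraidGroup n :=
  if h : 1 ≤ i ∧ i ≤ n then PresentedGroup.of (rels := braidRelators n) ⟨i - 1, by omega⟩ else 1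

/-- The element of `B⁺_{n+1}` given by a positive word, i.e. a list of indices of
Artin generators. -/
def w (n : ℕ) (L : List ℕ) : BraidMonoid n := (L.map (a n)).prod

/-- The element of `B_{n+1}` given by a positive word. -/
def wG (n : ℕ) (L : List ℕ) : BraidGroup n := (L.map (b n)).prod

/-- `Λ_i = a_i a_{i-1} ⋯ a_1`. -/
def Lam (n i : ℕ) : BraidMonoid n := ((List.range i).reverse.map (fun m => a n (m + 1))).prod

/-- `Λ_i^{(−)} = a_i a_{i-1} ⋯ a_2`  (`Λ_1^{(−)} = 1`). -/
def LamM (n i : ℕ) : BraidMonoid n :=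
  ((List.range (i - 1)).reverse.map (fun m => a n (m + 2))).prod

/-- `Λ_i^{(−−)} = a_i a_{i-1} ⋯ a_3`  (`Λ_2^{(−−)} = 1`). -/
def LamMM (n i : ℕ) : BraidMonoid n :=
  ((List.range (i - 2)).reverse.map (fun m => a n (m + 3))).prod

/-- `Δ_i = Λ_1 Λ_2 ⋯ Λ_i`. -/
def DeltaI (n i : ℕ) : BraidMonoid n := ((List.range i).map (fun m => Lam n (m + 1))).prod

/-- The Garside element `Δ = Λ_1 Λ_2 ⋯ Λ_n`. -/
def Delta (n : ℕ) : BraidMonoid n := DeltaI n n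

/-- `Λ_i` in the braid group. -/
def LamG (n i : ℕ) : BraidGroup n := ((List.range i).reverse.map (fun m => b n (m + 1))).prod

/-- `Δ_i = Λ_1 Λ_2 ⋯ Λ_i` in the braid group. -/
def DeltaIG (n i : ℕ) : BraidGroup n := ((List.range i).map (fun m => LamG n (m + 1))).prod

/-- The descending run `a_{ij} = a_i a_{i-1} ⋯ a_j` (`j ≤ i`), with `a_{i,i+1} = 1`. -/
def run (n i j : ℕ) : BraidMonoid n :=
  ((List.range (i + 1 - j)).reverse.map (fun m => a n (m + j))).prod

end Braid

namespace Braid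

theorem a_eq_of {n i : ℕ} (h : 1 ≤ i ∧ i ≤ n) :
    a n i = PresentedMonoid.of (braidRels n) ⟨i - 1, by omega⟩ := dif_pos h

theorem a_eq_one {n i : ℕ} (h : ¬(1 ≤ i ∧ i ≤ n)) : a n i = 1 := dif_neg h

theorem mk_eq_mk_of_rel {n : ℕ} {x y : FreeMonoid (Fin n)} (h : braidRels n x y) :
    (PresentedMonoid.mk (braidRels n) x : BraidMonoid n) = PresentedMonoid.mk (braidRels n) y :=
  (Con.eq _).2 (ConGen.Rel.of _ _ h)

theorem a_braid {n i : ℕ} (hi : 1 ≤ i) (hin : i + 1 ≤ n) :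
    a n (i + 1) * a n i * a n (i + 1) = a n i * a n (i + 1) * a n i := by
  rw [a_eq_of (i := i + 1) (by omega), a_eq_of (i := i) (by omega)]
  exact mk_eq_mk_of_rel
    (Or.inl ⟨⟨i - 1, by omega⟩, ⟨i + 1 - 1, by omega⟩, by simp only; omega, rfl, rfl⟩)

theorem a_comm (n : ℕ) {s k : ℕ} (hsk : s + 2 ≤ k) : Commute (a n k) (a n s) := by
  by_cases hs : 1 ≤ s ∧ s ≤ n
  · by_cases hk : 1 ≤ k ∧ k ≤ n
    · rw [a_eq_of hs, a_eq_of hk]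
      exact mk_eq_mk_of_rel
        (Or.inr ⟨⟨s - 1, by omega⟩, ⟨k - 1, by omega⟩, by simp only; omega, rfl, rfl⟩)
    · rw [a_eq_one hk]
      exact Commute.one_left _
  · rw [a_eq_one hs]
    exact Commute.one_right _

theorem Lam_succ (n i : ℕ) : Lam n (i + 1) = a n (i + 1) * Lam n i := by
  simp [Lam, List.range_succ]

theorem a_comm_Lam (n : ℕ) {i k : ℕ} (hik : i + 2 ≤ k) : Commute (a n k) (Lam n i) := by
  induction i with
  | zero => simp [Lam]
  | succ i ih =>
    rw [Lam_succ]
    exact (a_comm n hik).mul_right (ih (by omega))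

/-- Moving a letter `a_m` with `m < i` rightwards across `Λ_i` shifts it to `a_{m+1}`. -/
theorem Lam_semiconj_a {n m i : ℕ} (hm : 1 ≤ m) (hmi : m < i) (hin : i ≤ n) :
    SemiconjBy (Lam n i) (a n (m + 1)) (a n m) := by
  induction i, hmi using Nat.le_induction with
  | base =>
    obtain ⟨j, rfl⟩ := Nat.exists_eq_add_of_le' hm
    rw [Lam_succ, Lam_succ, ← mul_assoc]
    refine SemiconjBy.mul_left ?_ (a_comm_Lam n le_rfl).symm
    rw [SemiconjBy, a_braid hm hin, mul_assoc]
  | succ i hi ih =>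
    rw [Lam_succ]
    exact SemiconjBy.mul_left (a_comm n (by omega)) (ih (by omega))

theorem Lam_semiconj_w {n i : ℕ} (hin : i ≤ n) (L : List ℕ) (hL : ∀ m ∈ L, 1 ≤ m ∧ m < i) :
    SemiconjBy (Lam n i) (w n (L.map (· + 1))) (w n L) := by
  induction L with
  | nil => simp [w]
  | cons m L ih =>
    simp only [List.forall_mem_cons] at hL
    simpa [w] using (Lam_semiconj_a hL.1.1 hL.1.2 hin).mul_right (by simpa [w] using ih hL.2)

theorem semiconjBy_prod_range {M : Type*} [Monoid M] {x : M} {f g : ℕ → M} {k : ℕ}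
    (h : ∀ t < k, SemiconjBy x (f t) (g t)) :
    SemiconjBy x ((List.range k).map f).prod ((List.range k).map g).prod := by
  induction k with
  | zero => simp
  | succ k ih =>
    simpa [List.range_succ] using
      (ih fun t ht => h t (by omega)).mul_right (h k (by omega))

theorem prod_Lam_mul_w {n k : ℕ} (hk : k + 1 ≤ n) (Vs : ℕ → List ℕ)
    (hVs : ∀ j, 1 ≤ j → j ≤ k → ∀ m ∈ Vs j, 1 ≤ m ∧ m ≤ j) :
    ((List.range k).map (fun t => Lam n (t + 1) * w n (Vs (t + 1)))).prod * Lam n (k + 1)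
      = DeltaI n (k + 1) *
        ((List.range k).map (fun t => w n ((Vs (t + 1)).map (· + (k - t))))).prod := by
  induction k with
  | zero => simp [DeltaI]
  | succ k ih =>
    have ih := ih (by omega) fun j h₁ h₂ => hVs j h₁ (by omega)
    have hV : SemiconjBy (Lam n (k + 1 + 1))
        ((List.range (k + 1)).map
          (fun t => w n ((Vs (t + 1)).map (· + (k + 1 - t))))).prod
        ((List.range (k + 1)).map (fun t => w n ((Vs (t + 1)).map (· + (k - t))))).prod := by
      refine semiconjBy_prod_range fun t ht => ?_
      have hshift : (Vs (t + 1)).map (· + (k + 1 - t))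
          = ((Vs (t + 1)).map (· + (k - t))).map (· + 1) := by
        rw [List.map_map]
        refine List.map_congr_left fun m _ => ?_
        simp only [Function.comp_apply]
        omega
      rw [hshift]
      refine Lam_semiconj_w hk _ fun m hm => ?_
      obtain ⟨p, hp, rfl⟩ := List.mem_map.1 hm
      have := hVs (t + 1) (by omega) (by omega) p hp
      omega
    have hD : DeltaI n (k + 1 + 1) = DeltaI n (k + 1) * Lam n (k + 1 + 1) := by
      simp [DeltaI, List.range_succ, mul_assoc]
    rw [hD, mul_assoc, hV.eq, List.range_succ, List.map_append, List.map_append,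
      List.prod_append, List.prod_append, ← mul_assoc, ← mul_assoc, ← ih]
    simp [mul_assoc]

end Braid


/-- For positive words `V_j` in the letters `a_1, …, a_j` (for `1 ≤ j ≤ n−1`),
in the positive braid monoid `B⁺_{n+1}` one has
`Λ_1 V_1 Λ_2 V_2 ⋯ Λ_{n−1} V_{n−1} Λ_n = Δ V_1^{(n−1)} V_2^{(n−2)} ⋯ V_{n−1}^{(1)}`
(the relations (3) of the Gröbner–Shirshov basis of `B_{n+1}` in the Artin–Garside
generators). -/
theorem gs_relation_three (n : ℕ) (hn : 1 ≤ n) (Vs : ℕ → List ℕ)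
    (hVs : ∀ j, 1 ≤ j → j ≤ n - 1 → ∀ m ∈ Vs j, 1 ≤ m ∧ m ≤ j) :
    ((List.range (n - 1)).map (fun t => Braid.Lam n (t + 1) * Braid.w n (Vs (t + 1)))).prod *
        Braid.Lam n n
      = Braid.Delta n *
        ((List.range (n - 1)).map
            (fun t => Braid.w n ((Vs (t + 1)).map (· + (n - 1 - t))))).prod := by
  obtain ⟨k, rfl⟩ := Nat.exists_eq_add_of_le' hn
  exact Braid.prod_Lam_mul_w le_rfl Vs hVs
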